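/- For each positive rational q there exists a function Â : [0,1) → ℝ which is C^∞ on [0,1) (smooth in the sense of ContDiffOn, including one-sided smoothness at β = 0), such that for every β ∈ [0,1) one has Â(β) ∈ (0, 1/(1+β)) and q·T₁(β,Â(β)) = T₂(β,Â(β)). (In particular the implicitly defined solution Â₁(β,q) extends smoothly to β = 0, and Â₁(β,q) → Â₁(0,q) ∈ (0,1) as β → 0⁺.) -/

import Mathlib

open Real Filter Topology

/-- The complete elliptic integral of the first kind,
`K(κ) = ∫₀¹ dv / √((1 - v²)(1 - κ² v²))`. -/
noncomputable def K (κ : ℝ) : ℝ :=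
  ∫ v in (0:ℝ)..1, 1 / Real.sqrt ((1 - v ^ 2) * (1 - κ ^ 2 * v ^ 2))

/-- The modulus `κ₁(β, A₁)`, defined by
`κ₁² = (A₁(1-β) + √(1-4βA₁²)) / (2√(1-4βA₁²))`. -/
noncomputable def κ₁ (β A₁ : ℝ) : ℝ :=
  Real.sqrt ((A₁ * (1 - β) + Real.sqrt (1 - 4 * β * A₁ ^ 2)) /
    (2 * Real.sqrt (1 - 4 * β * A₁ ^ 2)))

/-- The modulus `κ₂(β)`, defined by `κ₂² = β/(1+β)`. -/
noncomputable def κ₂ (β : ℝ) : ℝ := Real.sqrt (β / (1 + β))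

/-- The period `T₁(β,A₁) = 2√(2/a) (1-4βA₁²)^{-1/4} K(κ₁(β,A₁))` of the ξ-motion. -/
noncomputable def T₁ (a β A₁ : ℝ) : ℝ :=
  2 * Real.sqrt (2 / a) / (1 - 4 * β * A₁ ^ 2) ^ ((1:ℝ)/4) * K (κ₁ β A₁)

/-- The period `T₂(β,A₁) = 2/√(a A₁ (1+β)) · K(κ₂(β))` of the φ-motion. -/
noncomputable def T₂ (a β A₁ : ℝ) : ℝ :=
  2 / Real.sqrt (a * A₁ * (1 + β)) * K (κ₂ β)

/-- The family of integrals closed under differentiation in the parameter `m = κ²`. -/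
noncomputable def ellJ (k : ℕ) (m : ℝ) : ℝ :=
  ∫ θ in (0:ℝ)..(π/2), (sin θ ^ 2) ^ k * (1 - m * sin θ ^ 2) ^ (-(k:ℝ) - 1/2)

lemma ell_base_pos {m : ℝ} (hm : m < 1) (θ : ℝ) : 0 < 1 - m * sin θ ^ 2 := by
  have h1 := sin_sq_le_one θ
  have h0 := sq_nonneg (sin θ)
  rcases le_or_gt m 0 with h | h
  · nlinarith
  · nlinarith

lemma ell_cont (k : ℕ) (p : ℝ) {m : ℝ} (hm : m < 1) :
    Continuous fun θ : ℝ => (sin θ ^ 2) ^ k * (1 - m * sin θ ^ 2) ^ p := by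
  refine Continuous.mul (by fun_prop) ?_
  exact Continuous.rpow_const (by fun_prop) (fun θ => Or.inl (ell_base_pos hm θ).ne')

lemma ellJ_hasDerivAt (k : ℕ) {m : ℝ} (hm : m < 1) :
    HasDerivAt (ellJ k) (((k:ℝ) + 1/2) * ellJ (k+1) m) m := by
  obtain ⟨c, hc0, hmc, hc1⟩ : ∃ c : ℝ, 0 ≤ c ∧ m < c ∧ c < 1 := by
    refine ⟨(max m 0 + 1) / 2, ?_, ?_, ?_⟩
    · have := le_max_right m 0; linarith
    · have := le_max_left m 0; linarith
    · have : max m 0 < 1 := max_lt hm one_pos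
      linarith
  have key := (intervalIntegral.hasDerivAt_integral_of_dominated_loc_of_deriv_le
    (μ := MeasureTheory.volume) (a := 0) (b := π/2) (x₀ := m) (s := Set.Iio c)
    (F := fun m θ => (sin θ ^ 2) ^ k * (1 - m * sin θ ^ 2) ^ (-(k:ℝ) - 1/2))
    (F' := fun m θ => ((k:ℝ) + 1/2) * ((sin θ ^ 2) ^ (k+1) *
      (1 - m * sin θ ^ 2) ^ (-((k+1 : ℕ):ℝ) - 1/2)))
    (bound := fun _ => ((k:ℝ) + 1/2) * (1 - c) ^ (-((k+1 : ℕ):ℝ) - 1/2))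
    (Iio_mem_nhds hmc) ?_ ?_ ?_ ?_ ?_ ?_).2
  · rw [intervalIntegral.integral_const_mul] at key
    exact key
  · filter_upwards [Iio_mem_nhds hm] with x hx
    exact (ell_cont k _ hx).aestronglyMeasurable
  · exact (ell_cont k _ hm).intervalIntegrable _ _
  · exact (continuous_const.mul (ell_cont (k+1) _ hm)).aestronglyMeasurable
  · refine Eventually.of_forall fun θ _ x hx => ?_
    have hx' : x < c := hx
    have h1 := sin_sq_le_one θ
    have h0 := sq_nonneg (sin θ)
    have hb := ell_base_pos (hx'.trans hc1) θ
    have hbc : 1 - c ≤ 1 - x * sin θ ^ 2 := by nlinarith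
    have hp : (0:ℝ) ≤ (1 - x * sin θ ^ 2) ^ (-((k+1 : ℕ):ℝ) - 1/2) := (rpow_pos_of_pos hb _).le
    rw [Real.norm_of_nonneg (by positivity)]
    have h2 : (sin θ ^ 2) ^ (k+1) ≤ 1 := pow_le_one₀ h0 h1
    have h3 : (1 - x * sin θ ^ 2) ^ (-((k+1 : ℕ):ℝ) - 1/2) ≤ (1 - c) ^ (-((k+1 : ℕ):ℝ) - 1/2) := by
      apply Real.rpow_le_rpow_of_nonpos (by linarith) hbc
      have : (0:ℝ) ≤ ((k+1:ℕ):ℝ) := Nat.cast_nonneg _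
      linarith
    have h4 : (sin θ ^ 2) ^ (k+1) * (1 - x * sin θ ^ 2) ^ (-((k+1 : ℕ):ℝ) - 1/2) ≤
        1 * (1 - c) ^ (-((k+1 : ℕ):ℝ) - 1/2) := mul_le_mul h2 h3 hp zero_le_one
    rw [one_mul] at h4
    exact mul_le_mul_of_nonneg_left h4 (by positivity)
  · exact intervalIntegrable_const
  · refine Eventually.of_forall fun θ _ x hx => ?_
    have hx' : x < c := hx
    have hb := ell_base_pos (hx'.trans hc1) θ
    have h1 : HasDerivAt (fun x : ℝ => 1 - x * sin θ ^ 2) (-(sin θ ^ 2)) x := by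
      simpa using ((hasDerivAt_id x).mul_const (sin θ ^ 2)).const_sub 1
    have h2 := (h1.rpow_const (p := -(k:ℝ) - 1/2) (Or.inl hb.ne')).const_mul ((sin θ ^ 2) ^ k)
    refine h2.congr_deriv ?_
    have : (-((k+1 : ℕ):ℝ) - 1/2) = -(k:ℝ) - 1/2 - 1 := by push_cast; ring
    rw [this]
    ring

lemma ellJ_contDiffOn_nat (n : ℕ) : ∀ k, ContDiffOn ℝ n (ellJ k) (Set.Iio 1) := by
  induction n with
  | zero =>
    intro k
    have : ContinuousOn (ellJ k) (Set.Iio 1) :=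
      fun m hm => (ellJ_hasDerivAt k hm).continuousAt.continuousWithinAt
    simpa using this
  | succ n ih =>
    intro k
    have h := contDiffOn_succ_iff_deriv_of_isOpen (𝕜 := ℝ) (n := (n : WithTop ℕ∞)) (f := ellJ k)
      (isOpen_Iio (a := (1:ℝ)))
    push_cast
    refine h.2 ⟨fun m hm => (ellJ_hasDerivAt k hm).differentiableAt.differentiableWithinAt, ?_, ?_⟩
    · simp
    · exact (contDiffOn_const.mul (ih (k+1))).congr fun m hm => (ellJ_hasDerivAt k hm).deriv

lemma ellJ_contDiffAt (k : ℕ) {m : ℝ} (hm : m < 1) : ContDiffAt ℝ (⊤ : ℕ∞) (ellJ k) m :=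
  (contDiffOn_infty.2 fun n => ellJ_contDiffOn_nat n k).contDiffAt (Iio_mem_nhds hm)

lemma ellJ_nonneg (k : ℕ) {m : ℝ} (hm : m < 1) : 0 ≤ ellJ k m := by
  apply intervalIntegral.integral_nonneg (by positivity)
  intro θ _
  have := ell_base_pos hm θ
  positivity

lemma ellJ_zero_pos {m : ℝ} (hm : m < 1) : 0 < ellJ 0 m := by
  apply intervalIntegral.intervalIntegral_pos_of_pos ((ell_cont 0 _ hm).intervalIntegrable _ _)
  · intro θ
    have := ell_base_pos hm θ
    positivity
  · positivity

lemma ellJ_zero_lower {ε : ℝ} (h0 : 0 < ε) : -log ε ≤ ellJ 0 (1 - ε ^ 2) := by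
  have hm : 1 - ε ^ 2 < 1 := by nlinarith
  have hpi := pi_gt_three
  have hcont : ContinuousOn (fun θ : ℝ => (π/2 + ε - θ)⁻¹) (Set.uIcc 0 (π/2)) := by
    intro θ hθ
    rw [Set.uIcc_of_le (by positivity)] at hθ
    have : π/2 + ε - θ ≠ 0 := by linarith [hθ.2]
    exact ContinuousAt.continuousWithinAt (by fun_prop (disch := assumption))
  have hI : ∫ θ in (0:ℝ)..(π/2), (π/2 + ε - θ)⁻¹ = log ((π/2 + ε)/ε) := by
    rw [intervalIntegral.integral_comp_sub_left (fun x => x⁻¹) (π/2+ε)]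
    rw [integral_inv_of_pos (by linarith) (by linarith)]
    congr 2 <;> ring
  have h1 : -log ε ≤ log ((π/2 + ε)/ε) := by
    rw [log_div (by positivity) h0.ne']
    have := log_nonneg (x := π/2 + ε) (by linarith)
    linarith
  refine h1.trans (hI ▸ ?_)
  apply intervalIntegral.integral_mono_on (by positivity) hcont.intervalIntegrable
    ((ell_cont 0 _ hm).intervalIntegrable _ _)
  intro θ hθ
  have hb := ell_base_pos hm θ
  have hpos : 0 < π/2 + ε - θ := by linarith [hθ.2]
  have hcos0 : 0 ≤ cos θ := cos_nonneg_of_mem_Icc ⟨by linarith [hθ.1], hθ.2⟩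
  have hcos : cos θ ≤ π/2 - θ := by
    rw [← sin_pi_div_two_sub]; exact sin_le (by linarith [hθ.2])
  have hle : 1 - (1 - ε^2) * sin θ ^ 2 ≤ (π/2 + ε - θ)^2 := by
    have := sin_sq_add_cos_sq θ
    have := sin_sq_le_one θ
    nlinarith [sq_nonneg ε, mul_nonneg h0.le hcos0]
  have h2 : ((π/2 + ε - θ)^2) ^ (-(1/2:ℝ)) ≤ (1 - (1 - ε^2) * sin θ ^ 2) ^ (-(1/2:ℝ)) :=
    Real.rpow_le_rpow_of_nonpos hb hle (by norm_num)
  rw [rpow_neg (by positivity), ← sqrt_eq_rpow, sqrt_sq hpos.le] at h2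
  simpa using h2

lemma K_eq_ellJ {κ : ℝ} (hκ : κ ^ 2 < 1) : K κ = ellJ 0 (κ ^ 2) := by
  have himg : sin '' Set.Ioo 0 (π/2) = Set.Ioo 0 1 := by
    ext v
    constructor
    · rintro ⟨θ, ⟨h1, h2⟩, rfl⟩
      refine ⟨sin_pos_of_pos_of_lt_pi h1 (by linarith [pi_pos]), ?_⟩
      rw [← sin_pi_div_two]
      exact sin_lt_sin_of_lt_of_le_pi_div_two (by linarith) le_rfl h2
    · rintro ⟨h1, h2⟩
      exact ⟨arcsin v, ⟨arcsin_pos.2 h1, arcsin_lt_pi_div_two.2 h2⟩, sin_arcsin (by linarith) h2.le⟩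
  have hinj : Set.InjOn sin (Set.Ioo 0 (π/2)) :=
    injOn_sin.mono (Set.Ioo_subset_Icc_self.trans (Set.Icc_subset_Icc_left (by linarith [pi_pos])))
  unfold K ellJ
  rw [intervalIntegral.integral_of_le zero_le_one, intervalIntegral.integral_of_le (by positivity),
    MeasureTheory.integral_Ioc_eq_integral_Ioo, MeasureTheory.integral_Ioc_eq_integral_Ioo, ← himg,
    MeasureTheory.integral_image_eq_integral_abs_deriv_smul (f' := cos) measurableSet_Ioo
      (fun θ _ => (hasDerivAt_sin θ).hasDerivWithinAt)
      hinj]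
  apply MeasureTheory.setIntegral_congr_fun measurableSet_Ioo
  intro θ hθ
  have hc : 0 < cos θ := cos_pos_of_mem_Ioo ⟨by linarith [hθ.1, pi_pos], hθ.2⟩
  have hb := ell_base_pos hκ θ
  have h1 : 1 - sin θ ^ 2 = cos θ ^ 2 := by linarith [sin_sq_add_cos_sq θ]
  simp only [smul_eq_mul, pow_zero, one_mul, Nat.cast_zero, neg_zero, zero_sub]
  rw [h1, sqrt_mul (by positivity), sqrt_sq hc.le, abs_of_pos hc, rpow_neg hb.le, ← sqrt_eq_rpow]
  field_simp

/-- The reduced one-variable function. -/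
noncomputable def ellH (w : ℝ) : ℝ := √w * ellJ 0 ((1 + w) / 2)

lemma ellH_contDiffAt {w : ℝ} (h0 : 0 < w) (h1 : w < 1) : ContDiffAt ℝ (⊤ : ℕ∞) ellH w := by
  refine ContDiffAt.mul (contDiffAt_sqrt h0.ne') ?_
  exact ContDiffAt.comp w (ellJ_contDiffAt 0 (by linarith)) (by fun_prop)

lemma ellH_hasDerivAt {w : ℝ} (h0 : 0 < w) (h1 : w < 1) : ∃ d : ℝ, 0 < d ∧ HasDerivAt ellH d w := by
  have hm : (1 + w) / 2 < 1 := by linarith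
  have hg : HasDerivAt (fun w : ℝ => (1 + w) / 2) (1/2) w :=
    ((hasDerivAt_id w).const_add 1).div_const 2
  have hJ := HasDerivAt.comp w (ellJ_hasDerivAt 0 hm) hg
  refine ⟨_, ?_, (hasDerivAt_sqrt h0.ne').mul hJ⟩
  have := ellJ_zero_pos hm
  have := ellJ_nonneg (0+1) hm
  have := sqrt_pos.2 h0
  positivity

lemma ellH_continuousOn : ContinuousOn ellH (Set.Ico 0 1) := by
  intro w hw
  have h1 : ContinuousAt (ellJ 0) ((1 + w)/2) := (ellJ_contDiffAt 0 (by linarith [hw.2])).continuousAt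
  have h2 : ContinuousAt (fun w => ellJ 0 ((1 + w)/2)) w :=
    ContinuousAt.comp (f := fun w : ℝ => (1 + w)/2) h1 (by fun_prop)
  exact (continuous_sqrt.continuousAt.mul h2).continuousWithinAt

lemma ellH_strictMonoOn : StrictMonoOn ellH (Set.Ico 0 1) := by
  apply strictMonoOn_of_deriv_pos (convex_Ico 0 1) ellH_continuousOn
  intro w hw
  rw [interior_Ico] at hw
  obtain ⟨d, hd, h⟩ := ellH_hasDerivAt hw.1 hw.2
  rwa [h.deriv]

lemma ellH_surj {y : ℝ} (hy : 0 < y) : ∃ w ∈ Set.Ioo (0:ℝ) 1, ellH w = y := by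
  set ε := exp (-(2*y+2)) with hε
  have hε0 : 0 < ε := exp_pos _
  have hε1 : ε ≤ 1/3 := by
    rw [hε, exp_neg]
    rw [inv_le_comm₀ (exp_pos _) (by norm_num)]
    have := add_one_le_exp (2*y+2)
    norm_num; linarith
  set w := 1 - 2 * ε^2 with hw
  have hw1 : w < 1 := by nlinarith
  have hw0 : 1/4 ≤ w := by nlinarith
  have hlow := ellJ_zero_lower hε0
  have hm : 1 - ε^2 = (1 + w)/2 := by rw [hw]; ring
  rw [hm, hε, log_exp] at hlow
  have hs : 1/2 ≤ √w := by
    apply le_sqrt_of_sq_le; linarith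
  have hH : y ≤ ellH w := by
    unfold ellH
    nlinarith
  have hH0 : ellH 0 = 0 := by simp [ellH]
  have := intermediate_value_Icc (a := 0) (b := w) (by linarith)
    (ellH_continuousOn.mono fun x hx => ⟨hx.1, hx.2.trans_lt hw1⟩)
  obtain ⟨x, hx, hxy⟩ := this ⟨by rw [hH0]; exact hy.le, hH⟩
  refine ⟨x, ⟨lt_of_le_of_ne hx.1 ?_, hx.2.trans_lt hw1⟩, hxy⟩
  rintro rfl
  linarith

lemma ellH_inv_contDiffAt (g : ℝ → ℝ) (hg : ∀ y, 0 < y → g y ∈ Set.Ioo (0:ℝ) 1 ∧ ellH (g y) = y)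
    {y : ℝ} (hy : 0 < y) : ContDiffAt ℝ (⊤ : ℕ∞) g y := by
  obtain ⟨⟨h0, h1⟩, hH⟩ := hg y hy
  obtain ⟨d, hd, hder⟩ := ellH_hasDerivAt h0 h1
  have hc := ellH_contDiffAt h0 h1
  have hf' := hder.hasFDerivAt_equiv hd.ne'
  have hn : ((⊤ : ℕ∞) : WithTop ℕ∞) ≠ 0 := by simp
  have hL := hc.to_localInverse hf' hn
  have himg := hc.localInverse_apply_image hf' hn
  have hright : ∀ᶠ z in 𝓝 (ellH (g y)), ellH (hc.localInverse hf' hn z) = z :=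
    (hc.hasStrictFDerivAt' hf' hn).eventually_right_inverse
  have hmem : ∀ᶠ z in 𝓝 (ellH (g y)), hc.localInverse hf' hn z ∈ Set.Ioo (0:ℝ) 1 :=
    hL.continuousAt.eventually_mem (by rw [himg]; exact Ioo_mem_nhds h0 h1)
  rw [hH] at hL hright hmem
  refine hL.congr_of_eventuallyEq ?_
  filter_upwards [hright, hmem, Ioi_mem_nhds hy] with z hz1 hz2 hz3
  obtain ⟨a1, a2⟩ := hg z hz3
  exact ellH_strictMonoOn.injOn ⟨a1.1.le, a1.2⟩ ⟨hz2.1.le, hz2.2⟩ (by rw [a2, hz1])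

lemma ell_equation {a q β w J1 J2 : ℝ} (ha : 0 < a) (h1 : β < 1) (h0 : 0 ≤ β)
    (hw : 0 < w) (hw1 : w < 1)
    (hJ1 : J1 = ellJ 0 ((1 + w) / 2)) (hJ2 : J2 = ellJ 0 (β / (1 + β)))
    (hq : 0 < q)
    (hE : √w * J1 = √((1-β)/(1+β)) * J2 / (q * √2)) :
    w / √((1-β)^2 + 4*β*w^2) ∈ Set.Ioo 0 (1 / (1 + β)) ∧
      q * T₁ a β (w / √((1-β)^2 + 4*β*w^2)) = T₂ a β (w / √((1-β)^2 + 4*β*w^2)) := by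
  set D := (1-β)^2 + 4*β*w^2 with hD
  have hb : 0 < 1 - β := by linarith
  have hb' : 0 < 1 + β := by linarith
  have hDpos : 0 < D := by positivity
  have hr : 0 < √D := sqrt_pos.2 hDpos
  have hr2 : √D ^ 2 = D := sq_sqrt hDpos.le
  set A := w / √D with hA
  have hApos : 0 < A := by positivity
  have hs2 : 1 - 4*β*A^2 = ((1-β)/√D)^2 := by
    rw [hA, div_pow, div_pow, hr2]
    field_simp
    rw [hD]; ring
  have hs : √(1 - 4*β*A^2) = (1-β)/√D := by rw [hs2, sqrt_sq (by positivity)]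
  have hs4 : (1 - 4*β*A^2) ^ ((1:ℝ)/4) = √(1-β)/√√D := by
    have : ((1:ℝ)/4) = (1/2) * (1/2) := by norm_num
    rw [this, rpow_mul (by rw [hs2]; positivity), ← sqrt_eq_rpow, ← sqrt_eq_rpow, hs,
      sqrt_div hb.le]
  have hk1 : κ₁ β A ^ 2 = (1 + w)/2 := by
    have : (A * (1 - β) + √(1 - 4*β*A^2)) / (2 * √(1 - 4*β*A^2)) = (1 + w)/2 := by
      rw [hs, hA]; field_simp; ring
    rw [κ₁, this, sq_sqrt (by positivity)]
  have hk2 : κ₂ β ^ 2 = β / (1 + β) := by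
    rw [κ₂, sq_sqrt (by positivity)]
  have hm2 : β / (1 + β) < 1 := by rw [div_lt_one hb']; linarith
  refine ⟨⟨hApos, ?_⟩, ?_⟩
  · rw [hA, div_lt_div_iff₀ hr hb', one_mul]
    apply lt_sqrt_of_sq_lt
    rw [hD]
    have : w^2 < 1 := by nlinarith
    nlinarith [mul_pos (pow_pos hb 2) (sub_pos.2 this)]
  · rw [T₁, T₂, K_eq_ellJ (by rw [hk1]; linarith), K_eq_ellJ (by rw [hk2]; exact hm2), hk1, hk2,
      ← hJ1, ← hJ2, hs4, sqrt_mul (by positivity), sqrt_mul ha.le, hA, sqrt_div hw.le,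
      sqrt_div (by norm_num)]
    rw [sqrt_div hb.le] at hE
    have e1 : 0 < √a := sqrt_pos.2 ha
    have e2 : 0 < √w := sqrt_pos.2 hw
    have e3 : 0 < √(1-β) := sqrt_pos.2 hb
    have e4 : 0 < √(1+β) := sqrt_pos.2 hb'
    have e5 : 0 < √√D := sqrt_pos.2 hr
    have e6 : 0 < √(2:ℝ) := sqrt_pos.2 (by norm_num)
    field_simp at hE ⊢
    linear_combination hE

/-- For each positive rational `q`, the implicitly defined solution `Ahat₁(·,q)` of
`q T₁(β,·) = T₂(β,·)` is a `C^∞` function of `β` on `[0,1)` (including one-sided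
smoothness at `β = 0`), taking values in `(0, 1/(1+β))`. -/
theorem A₁_smooth_in_beta (a : ℝ) (ha : 0 < a) (q : ℚ) (hq : 0 < q) :
    ∃ Ahat : ℝ → ℝ, ContDiffOn ℝ (⊤ : ℕ∞) Ahat (Set.Ico (0:ℝ) 1) ∧
      ∀ β ∈ Set.Ico (0:ℝ) 1,
        Ahat β ∈ Set.Ioo 0 (1 / (1 + β)) ∧ (q : ℝ) * T₁ a β (Ahat β) = T₂ a β (Ahat β) := by
  have hq' : (0:ℝ) < q := by exact_mod_cast hq
  choose! g hg using fun (y : ℝ) (hy : 0 < y) => ellH_surj hy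
  have h2 : 0 < √(2:ℝ) := sqrt_pos.2 (by norm_num)
  set R : ℝ → ℝ := fun β => √((1-β)/(1+β)) * ellJ 0 (β / (1 + β)) / (q * √2) with hR
  have hm : ∀ β ∈ Set.Ico (0:ℝ) 1, β / (1 + β) < 1 := by
    intro β hβ
    rw [div_lt_one (by linarith [hβ.1])]; linarith
  have hfrac : ∀ β ∈ Set.Ico (0:ℝ) 1, 0 < (1-β)/(1+β) := by
    intro β hβ
    exact div_pos (by linarith [hβ.2]) (by linarith [hβ.1])
  have hRpos : ∀ β ∈ Set.Ico (0:ℝ) 1, 0 < R β := by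
    intro β hβ
    have e1 := ellJ_zero_pos (hm β hβ)
    have e2 := sqrt_pos.2 (hfrac β hβ)
    exact div_pos (mul_pos e2 e1) (mul_pos hq' h2)
  refine ⟨fun β => g (R β) / √((1-β)^2 + 4*β*(g (R β))^2), ?_, ?_⟩
  · intro β hβ
    apply ContDiffAt.contDiffWithinAt
    have hne : 1 + β ≠ 0 := by linarith [hβ.1]
    have c1 : ContDiffAt ℝ (⊤ : ℕ∞) (fun β : ℝ => (1-β)/(1+β)) β :=
      ContDiffAt.div (by fun_prop) (by fun_prop) hne
    have c2 : ContDiffAt ℝ (⊤ : ℕ∞) (fun β : ℝ => β/(1+β)) β :=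
      ContDiffAt.div (by fun_prop) (by fun_prop) hne
    have c3 : ContDiffAt ℝ (⊤ : ℕ∞) (fun β : ℝ => ellJ 0 (β/(1+β))) β :=
      ContDiffAt.comp β (ellJ_contDiffAt 0 (hm β hβ)) c2
    have cR : ContDiffAt ℝ (⊤ : ℕ∞) R β :=
      ((c1.sqrt (hfrac β hβ).ne').mul c3).div_const _
    have cg : ContDiffAt ℝ (⊤ : ℕ∞) (fun β => g (R β)) β :=
      ContDiffAt.comp β (ellH_inv_contDiffAt g hg (hRpos β hβ)) cR
    have hD : 0 < (1-β)^2 + 4*β*(g (R β))^2 := by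
      have e1 : 0 < 1 - β := by linarith [hβ.2]
      have e2 := hβ.1
      positivity
    have cD : ContDiffAt ℝ (⊤ : ℕ∞) (fun β => (1-β)^2 + 4*β*(g (R β))^2) β := by
      refine ContDiffAt.add (by fun_prop) (ContDiffAt.mul (by fun_prop) (cg.pow 2))
    exact cg.div (cD.sqrt hD.ne') (sqrt_pos.2 hD).ne'
  · intro β hβ
    obtain ⟨⟨hw0, hw1⟩, hH⟩ := hg _ (hRpos β hβ)
    exact ell_equation ha hβ.2 hβ.1 hw0 hw1 rfl rfl hq' hH
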